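/- arXiv:2112.14682 — 2 statements merged into one kernel-verified Lean document; each statement's English description precedes it below -/
import Mathlib

section
/- Let f : {0,1}^n → {0,1} be a symmetric Boolean function (i.e., f(x) depends only on the Hamming weight |x|) with f(0^n) = 1, and let p be a multilinear polynomial in n variables over ℂ that is a non-deterministic polynomial for f, meaning that for all x ∈ {0,1}^n, p(x) = 0 if and only if f(x) = 0. Then deg(p) ≥ |{i ∈ {1, ..., n} : f(x) = 0 for all x with |x| = i}|. In particular, the non-deterministic degree ndeg(f) is at least the number of Hamming weights in {1,...,n} on which f takes the value 0. -/
/-- Hamming weight of a Boolean string. -/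
def hamWt {n : ℕ} (x : Fin n → Bool) : ℕ :=
  (Finset.univ.filter (fun i => x i = true)).card

/-- View a Boolean string as a 0/1 complex input. -/
def bval {n : ℕ} (x : Fin n → Bool) : Fin n → ℂ :=
  fun i => if x i then 1 else 0

/-- The univariate symmetrization of `p`: its value at a natural number `w ≤ n` is
the average of `p` over the Boolean points of Hamming weight `w`. -/
noncomputable def cubeSymmetrization {n : ℕ} (p : MvPolynomial (Fin n) ℂ) : Polynomial ℂ :=
  ∑ m ∈ p.support,
    Polynomial.C (p.coeff m / (n.descFactorial m.support.card : ℂ)) *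
      descPochhammer ℂ m.support.card

lemma hamWt_decide_mem {n : ℕ} (A : Finset (Fin n)) :
    hamWt (fun i => decide (i ∈ A)) = A.card := by
  simp [hamWt]

lemma eval_bval_decide_mem {n : ℕ} (p : MvPolynomial (Fin n) ℂ) (A : Finset (Fin n)) :
    MvPolynomial.eval (bval fun i => decide (i ∈ A)) p =
      ∑ m ∈ p.support, p.coeff m * if m.support ⊆ A then 1 else 0 := by
  rw [MvPolynomial.eval_eq]
  refine Finset.sum_congr rfl fun m _ => ?_
  congr 1
  split_ifs with h
  · exact Finset.prod_eq_one fun i hi => by simp [bval, h hi]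
  · obtain ⟨i, hi, hiA⟩ := Finset.not_subset.1 h
    exact Finset.prod_eq_zero hi (by simp [bval, hiA, Finsupp.mem_support_iff.1 hi])

lemma natDegree_cubeSymmetrization_le {n : ℕ} (p : MvPolynomial (Fin n) ℂ) :
    (cubeSymmetrization p).natDegree ≤ p.totalDegree := by
  refine Polynomial.natDegree_sum_le_of_forall_le _ _ fun m hm => ?_
  refine (Polynomial.natDegree_C_mul_le _ _).trans ?_
  rw [descPochhammer_natDegree]
  refine le_trans ?_ (MvPolynomial.le_totalDegree hm)
  rw [Finset.card_eq_sum_ones]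
  exact Finset.sum_le_sum fun i hi => Nat.one_le_iff_ne_zero.2 (Finsupp.mem_support_iff.1 hi)

lemma choose_mul_descFactorial_eq {n : ℕ} (w : ℕ) (S : Finset (Fin n)) :
    n.choose w * w.descFactorial S.card =
      ((Finset.univ.powersetCard w).filter (S ⊆ ·)).card * n.descFactorial S.card := by
  rcases lt_or_ge w S.card with hw | hw
  · have : (Finset.univ.powersetCard w).filter (S ⊆ ·) = ∅ := by
      refine Finset.filter_eq_empty_iff.2 fun A hA hSA => ?_
      have := Finset.card_le_card hSA
      rw [(Finset.mem_powersetCard.1 hA).2] at this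
      omega
    simp [this, Nat.descFactorial_eq_zero_iff_lt.2 hw]
  · rw [Finset.card_filter_powersetCard_subset _ _ _ (Finset.subset_univ _) hw,
      Finset.card_univ, Fintype.card_fin, Nat.descFactorial_eq_factorial_mul_choose,
      Nat.descFactorial_eq_factorial_mul_choose, mul_left_comm, Nat.choose_mul hw]
    ring

lemma choose_mul_eval_cubeSymmetrization {n : ℕ} (p : MvPolynomial (Fin n) ℂ) (w : ℕ) :
    (n.choose w : ℂ) * (cubeSymmetrization p).eval (w : ℂ) =
      ∑ A ∈ Finset.univ.powersetCard w,
        MvPolynomial.eval (bval fun i => decide (i ∈ A)) p := by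
  simp_rw [eval_bval_decide_mem]
  rw [Finset.sum_comm, cubeSymmetrization, Polynomial.eval_finsetSum, Finset.mul_sum]
  refine Finset.sum_congr rfl fun m _ => ?_
  have hs : m.support.card ≤ n := by simpa using m.support.card_le_univ
  have hne : (n.descFactorial m.support.card : ℂ) ≠ 0 := by
    simpa [Nat.descFactorial_eq_zero_iff_lt] using hs
  have key := congrArg (Nat.cast : ℕ → ℂ) (choose_mul_descFactorial_eq w m.support)
  push_cast at key
  rw [← Finset.mul_sum, Finset.sum_boole, Polynomial.eval_mul, Polynomial.eval_C,
    descPochhammer_eval_eq_descFactorial, mul_left_comm, key]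
  field_simp

/-- If `f` is a symmetric Boolean function with `f(0^n) = 1` and `p` is a
multilinear non-deterministic polynomial for `f` (i.e. `p(x) = 0 ↔ f(x) = 0`
on the Boolean cube), then `deg p` is at least the number of Hamming weights
in `{1, …, n}` on which `f` takes the value `0`. -/
theorem stmt_2 (n : ℕ) (f : (Fin n → Bool) → Bool)
    (hsym : ∀ x y : Fin n → Bool, hamWt x = hamWt y → f x = f y)
    (h0 : f (fun _ => false) = true)
    (p : MvPolynomial (Fin n) ℂ)
    (hml : ∀ i : Fin n, p.degreeOf i ≤ 1)
    (hnd : ∀ x : Fin n → Bool, MvPolynomial.eval (bval x) p = 0 ↔ f x = false) :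
    ((Finset.Icc 1 n).filter
        (fun i => ∀ x : Fin n → Bool, hamWt x = i → f x = false)).card
      ≤ p.totalDegree := by
  set q := cubeSymmetrization p with hq
  set T := (Finset.Icc 1 n).filter
    (fun i => ∀ x : Fin n → Bool, hamWt x = i → f x = false)
  have hq0 : q ≠ 0 := by
    intro h
    have h1 := choose_mul_eval_cubeSymmetrization p 0
    rw [← hq, h] at h1
    have h2 := (hnd fun _ => false).1 (by simpa using h1.symm)
    simp [h0] at h2
  have hroots : (T.image (Nat.cast : ℕ → ℂ)).val ⊆ q.roots := by
    intro z hz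
    rw [Finset.mem_val] at hz
    obtain ⟨w, hw, rfl⟩ := Finset.mem_image.1 hz
    obtain ⟨hwn, hw⟩ := Finset.mem_filter.1 hw
    rw [Polynomial.mem_roots hq0, Polynomial.IsRoot.def]
    have h1 := choose_mul_eval_cubeSymmetrization p w
    rw [Finset.sum_eq_zero fun A hA => (hnd _).2
      (hw _ ((hamWt_decide_mem A).trans (Finset.mem_powersetCard.1 hA).2))] at h1
    refine (mul_eq_zero.1 h1).resolve_left ?_
    exact_mod_cast (Nat.choose_pos (Finset.mem_Icc.1 hwn).2).ne'
  calc T.card = (T.image (Nat.cast : ℕ → ℂ)).card :=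
        (Finset.card_image_of_injective _ Nat.cast_injective).symm
    _ ≤ q.natDegree := Polynomial.card_le_degree_of_subset_roots hroots
    _ ≤ p.totalDegree := natDegree_cubeSymmetrization_le p
end

section
/- For all x, y ∈ {0,1}³, letting a_i = (−1)^{x_i} and b_i = (−1)^{y_i} for i = 1,2,3, the inner product G_{x,y} = ⟨ψ(x), ψ(y)⟩ of the final states satisfies 16·G_{x,y} = 1 + (a₁a₂ + a₁a₃ + a₂a₃) + (b₁b₂ + b₁b₃ + b₂b₃) + 2(a₁b₁ + a₂b₂ + a₃b₃) + 3(a₁a₂b₁b₂ + a₁a₃b₁b₃ + a₂a₃b₂b₃) − (a₁b₂ + a₁b₃ + a₂b₁ + a₂b₃ + a₃b₁ + a₃b₂). -/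
open Matrix

noncomputable section

/-- `ω = e^{2πi/3}`, a primitive cube root of unity. -/
def ω : ℂ := Complex.exp (2 * Real.pi * Complex.I / 3)

/-- The 3×3 quantum Fourier transform acting on the first three of five
basis states, and as the identity on the last two. -/
def QFT : Matrix (Fin 5) (Fin 5) ℂ :=
  ((Real.sqrt 3 : ℂ))⁻¹ •
    !![1, 1, 1, 0, 0;
       1, ω, ω ^ 2, 0, 0;
       1, ω ^ 2, ω, 0, 0;
       0, 0, 0, (Real.sqrt 3 : ℂ), 0;
       0, 0, 0, 0, (Real.sqrt 3 : ℂ)]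

/-- The first non-query unitary of the mod-3 algorithm. -/
def U : Matrix (Fin 5) (Fin 5) ℂ :=
  (1 / 4 : ℂ) •
    !![4, 0, 0, 0, 0;
       0, -(1/2) + Complex.I * (3 * (Real.sqrt 3 : ℂ) / 2), 0, 3, 0;
       0, 0, -(1/2) - Complex.I * (3 * (Real.sqrt 3 : ℂ) / 2), 0, 3;
       0, 3, 0, (1/2) + Complex.I * (3 * (Real.sqrt 3 : ℂ) / 2), 0;
       0, 0, 3, 0, (1/2) - Complex.I * (3 * (Real.sqrt 3 : ℂ) / 2)]

/-- The second non-query unitary of the mod-3 algorithm. -/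
def V : Matrix (Fin 5) (Fin 5) ℂ :=
  ((Real.sqrt 2 : ℂ))⁻¹ •
    !![(Real.sqrt 2 : ℂ), 0, 0, 0, 0;
       0, (1/2) - Complex.I * ((Real.sqrt 3 : ℂ) / 2), 0, 1, 0;
       0, 0, (1/2) + Complex.I * ((Real.sqrt 3 : ℂ) / 2), 0, 1;
       0, 1, 0, -(1/2) - Complex.I * ((Real.sqrt 3 : ℂ) / 2), 0;
       0, 0, 1, 0, -(1/2) + Complex.I * ((Real.sqrt 3 : ℂ) / 2)]

/-- The phase oracle for a 3-bit input, acting trivially on the last two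
dimensions: `O_x = diag((-1)^{x₁}, (-1)^{x₂}, (-1)^{x₃}, 1, 1)`. -/
def Ox (x : Fin 3 → Bool) : Matrix (Fin 5) (Fin 5) ℂ :=
  !![(if x 0 then -1 else 1 : ℂ), 0, 0, 0, 0;
     0, (if x 1 then -1 else 1 : ℂ), 0, 0, 0;
     0, 0, (if x 2 then -1 else 1 : ℂ), 0, 0;
     0, 0, 0, 1, 0;
     0, 0, 0, 0, 1]

/-- The final state of the 2-query mod-3 algorithm:
`|ψ(x)⟩ = V (QFT† O_x QFT) U (QFT† O_x QFT) e₀`. -/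
def ψ (x : Fin 3 → Bool) : Fin 5 → ℂ :=
  (V * (QFTᴴ * Ox x * QFT) * U * (QFTᴴ * Ox x * QFT)).mulVec
    (Pi.single (0 : Fin 5) (1 : ℂ))

end

theorem sqrt_three_sq : (Real.sqrt 3 : ℂ) ^ 2 = 3 := by
  rw [← Complex.ofReal_pow, Real.sq_sqrt (by norm_num)]
  norm_num

theorem ω_eq : ω = -(1 / 2) + Complex.I * ((Real.sqrt 3 : ℂ) / 2) := by
  have h : (2 * Real.pi * Complex.I / 3 : ℂ) = ((Real.pi - Real.pi / 3 : ℝ) : ℂ) * Complex.I := by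
    push_cast
    ring
  rw [ω, h, Complex.exp_mul_I, ← Complex.ofReal_cos, ← Complex.ofReal_sin, Real.cos_pi_sub,
    Real.sin_pi_sub, Real.cos_pi_div_three, Real.sin_pi_div_three]
  push_cast
  ring

theorem ω_sq : ω ^ 2 = -1 - ω := by
  rw [ω_eq]
  linear_combination (1 / 4 : ℂ) * (Real.sqrt 3 : ℂ) ^ 2 * Complex.I_sq - 1 / 4 * sqrt_three_sq

theorem star_ω : (starRingEnd ℂ) ω = -1 - ω := by
  rw [ω_eq]
  simp only [map_add, map_neg, map_mul, map_div₀, map_one, map_ofNat, Complex.conj_I,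
    Complex.conj_ofReal]
  ring

/-- The sign `(-1)^b` of a bit. -/
def bitSign (b : Bool) : ℂ := if b then -1 else 1

theorem bitSign_sq (b : Bool) : bitSign b ^ 2 = 1 := by
  cases b <;> simp [bitSign]

theorem conj_bitSign (b : Bool) : (starRingEnd ℂ) (bitSign b) = bitSign b := by
  cases b <;> simp [bitSign]

/-- In the Fourier basis the phase oracle is circulant. -/
theorem QFT_conjTranspose_mul_Ox_mul_QFT (x : Fin 3 → Bool) :
    let A := (bitSign (x 0) + bitSign (x 1) + bitSign (x 2)) / 3
    let B := (bitSign (x 0) + ω * bitSign (x 1) + (-1 - ω) * bitSign (x 2)) / 3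
    let C := (bitSign (x 0) + (-1 - ω) * bitSign (x 1) + ω * bitSign (x 2)) / 3
    QFTᴴ * Ox x * QFT =
      !![A, B, C, 0, 0; C, A, B, 0, 0; B, C, A, 0, 0; 0, 0, 0, 1, 0; 0, 0, 0, 0, 1] := by
  have hs : (Real.sqrt 3 : ℂ)⁻¹ * (Real.sqrt 3 : ℂ)⁻¹ = 1 / 3 := by
    rw [← mul_inv, ← pow_two, sqrt_three_sq, one_div]
  have hOx : Ox x = Matrix.diagonal ![bitSign (x 0), bitSign (x 1), bitSign (x 2), 1, 1] := by
    ext i j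
    fin_cases i <;> fin_cases j <;> simp [Ox, bitSign, Matrix.diagonal]
  intro A B C
  have hω := ω_sq
  ext i j
  rw [hOx, Matrix.mul_apply]
  simp only [Matrix.mul_diagonal, Matrix.conjTranspose_apply, Fin.sum_univ_five]
  fin_cases i <;> fin_cases j <;>
    simp [QFT, ω_sq, star_ω, A, B, C] <;>
    grind

/-- The final state, expanded in the characters of the input. -/
theorem ψ_eq (x : Fin 3 → Bool) :
    let a := bitSign (x 0)
    let b := bitSign (x 1)
    let c := bitSign (x 2)
    let p := a * b + (-1 - ω) * (b * c) + ω * (a * c)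
    let q := a * b + ω * (b * c) + (-1 - ω) * (a * c)
    let r := a + (-1 - ω) * b + ω * c
    let s := a + ω * b + (-1 - ω) * c
    ψ x = ![(1 + a * b + a * c + b * c) / 4,
      (Real.sqrt 2 : ℂ)⁻¹ * ((-ω * p + r) / 4),
      (Real.sqrt 2 : ℂ)⁻¹ * (((1 + ω) * q + s) / 4),
      (Real.sqrt 2 : ℂ)⁻¹ * ((p + (-1 - ω) * r) / 4),
      (Real.sqrt 2 : ℂ)⁻¹ * ((q + ω * s) / 4)] := by
  intro a b c p q r s
  have hω := ω_sq
  have ha : a ^ 2 = 1 := bitSign_sq _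
  have hb : b ^ 2 = 1 := bitSign_sq _
  have hc : c ^ 2 = 1 := bitSign_sq _
  have hU : U = (1 / 4 : ℂ) • !![4, 0, 0, 0, 0; 0, 1 + 3 * ω, 0, 3, 0; 0, 0, -2 - 3 * ω, 0, 3;
      0, 3, 0, 2 + 3 * ω, 0; 0, 0, 3, 0, -1 - 3 * ω] := by
    rw [U, ω_eq]
    congr 6 <;> ring_nf
  have hV : V = (Real.sqrt 2 : ℂ)⁻¹ • !![(Real.sqrt 2 : ℂ), 0, 0, 0, 0; 0, -ω, 0, 1, 0;
      0, 0, 1 + ω, 0, 1; 0, 1, 0, -1 - ω, 0; 0, 0, 1, 0, ω] := by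
    rw [V, ω_eq]
    congr 6 <;> ring_nf
  have hO := QFT_conjTranspose_mul_Ox_mul_QFT x
  have hφ : (QFTᴴ * Ox x * QFT) *ᵥ (U *ᵥ ((QFTᴴ * Ox x * QFT) *ᵥ Pi.single 0 1)) =
      ![(1 + a * b + a * c + b * c) / 4, p / 4, q / 4, r / 4, s / 4] := by
    rw [hO, hU]
    ext i
    fin_cases i <;>
      simp [Matrix.mulVec, dotProduct, Fin.sum_univ_five, p, q, r, s] <;>
      grind
  rw [ψ, ← Matrix.mulVec_mulVec, ← Matrix.mulVec_mulVec, ← Matrix.mulVec_mulVec, hφ, hV]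
  ext i
  fin_cases i <;> simp [Matrix.mulVec, dotProduct, Fin.sum_univ_five] <;> field_simp

/-- Explicit formula for the Gram matrix of the final states: with
`aᵢ = (-1)^{xᵢ}` and `bᵢ = (-1)^{yᵢ}`,
`16 ⟨ψ(x), ψ(y)⟩ = 1 + (a₁a₂ + a₁a₃ + a₂a₃) + (b₁b₂ + b₁b₃ + b₂b₃)
 + 2(a₁b₁ + a₂b₂ + a₃b₃) + 3(a₁a₂b₁b₂ + a₁a₃b₁b₃ + a₂a₃b₂b₃)
 - (a₁b₂ + a₁b₃ + a₂b₁ + a₂b₃ + a₃b₁ + a₃b₂)`. -/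
theorem stmt_13 (x y : Fin 3 → Bool) :
    let a : Fin 3 → ℂ := fun i => if x i then -1 else 1
    let b : Fin 3 → ℂ := fun i => if y i then -1 else 1
    16 * ∑ j : Fin 5, (starRingEnd ℂ) (ψ x j) * ψ y j =
      1 + (a 0 * a 1 + a 0 * a 2 + a 1 * a 2)
        + (b 0 * b 1 + b 0 * b 2 + b 1 * b 2)
        + 2 * (a 0 * b 0 + a 1 * b 1 + a 2 * b 2)
        + 3 * (a 0 * a 1 * b 0 * b 1 + a 0 * a 2 * b 0 * b 2 + a 1 * a 2 * b 1 * b 2)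
        - (a 0 * b 1 + a 0 * b 2 + a 1 * b 0 + a 1 * b 2 + a 2 * b 0 + a 2 * b 1) := by
  intro a b
  have hω := ω_sq
  have h₂ : (Real.sqrt 2 : ℂ)⁻¹ ^ 2 = 1 / 2 := by
    rw [inv_pow, ← Complex.ofReal_pow, Real.sq_sqrt (by norm_num)]
    norm_num
  have ha (i : Fin 3) : bitSign (x i) = a i := rfl
  have hb (i : Fin 3) : bitSign (y i) = b i := rfl
  have ha' (i : Fin 3) : (starRingEnd ℂ) (a i) = a i := conj_bitSign (x i)
  simp only [ψ_eq, Fin.sum_univ_five, ha, hb]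
  clear_value a b
  have h₄ : (starRingEnd ℂ) 4 = 4 := map_ofNat _ 4
  simp [star_ω, ha', h₄]
  grind
end
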